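/- arXiv:2412.09843 — 2 statements merged into one kernel-verified Lean document; each statement's English description precedes it below -/
import Mathlib

section
/- Let d ∈ ℕ, let π be a permutation of {1, …, d}, and for each i ∈ {1, …, d} let v^i : ℝ → ℝ^d → ℝ → ℝ be a velocity function such that: (i) v^i(z, u, t) depends on the vector u only through the coordinates u^j with π(j) < π(i); (ii) (z, t) ↦ v^i(z, u, t) is continuous on ℝ × [0,1] for every u; and (iii) there is K ≥ 0 such that |v^i(z₁, u, t) − v^i(z₂, u, t)| ≤ K·|z₁ − z₂| for all z₁, z₂ ∈ ℝ, all u ∈ ℝ^d, all t ∈ [0,1], and all i. Suppose that for every u ∈ ℝ^d there are functions z^1(u, ·), …, z^d(u, ·) : [0,1] → ℝ with z^i(u, 0) = u^i and, for every t ∈ [0,1], z^i(u, ·) has derivative v^i(z^i(u, t), u, t) at t. Define f(u, t) ∈ ℝ^d by f(u, t)_i = z^i(u, t). Then for every t ∈ [0,1], the map u ↦ f(u, t) is a triangular monotonically increasing map with respect to π: (a) the i-th component f(u, t)_i depends only on the coordinates u^j with π(j) ≤ π(i); and (b) for fixed values of all coordinates u^j with j ≠ i, the map u^i ↦ f(u,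 t)_i is strictly increasing. -/
/-- Two solutions on `[a, b]` of an ODE with Lipschitz right-hand side that agree at `a` agree on
`[a, b]`. -/
theorem ODE_solution_eqOn_Icc_of_eq_left {E : Type*} [NormedAddCommGroup E] [NormedSpace ℝ E]
    {v : ℝ → E → E} {K : NNReal} {x y : ℝ → E} {a b : ℝ}
    (hv : ∀ t ∈ Set.Icc a b, LipschitzWith K (v t))
    (hx : ∀ t ∈ Set.Icc a b, HasDerivAt x (v t (x t)) t)
    (hy : ∀ t ∈ Set.Icc a b, HasDerivAt y (v t (y t)) t)
    (h : x a = y a) : Set.EqOn x y (Set.Icc a b) :=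
  ODE_solution_unique_of_mem_Icc_right (s := fun _ => Set.univ)
    (fun t ht => (hv t (Set.Ico_subset_Icc_self ht)).lipschitzOnWith)
    (HasDerivAt.continuousOn hx)
    (fun t ht => (hx t (Set.Ico_subset_Icc_self ht)).hasDerivWithinAt) (fun _ _ => trivial)
    (HasDerivAt.continuousOn hy)
    (fun t ht => (hy t (Set.Ico_subset_Icc_self ht)).hasDerivWithinAt) (fun _ _ => trivial) h

/-- Two solutions on `[a, b]` of an ODE with Lipschitz right-hand side that agree at `b` agree on
`[a, b]`. -/
theorem ODE_solution_eqOn_Icc_of_eq_right {E : Type*} [NormedAddCommGroup E] [NormedSpace ℝ E]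
    {v : ℝ → E → E} {K : NNReal} {x y : ℝ → E} {a b : ℝ}
    (hv : ∀ t ∈ Set.Icc a b, LipschitzWith K (v t))
    (hx : ∀ t ∈ Set.Icc a b, HasDerivAt x (v t (x t)) t)
    (hy : ∀ t ∈ Set.Icc a b, HasDerivAt y (v t (y t)) t)
    (h : x b = y b) : Set.EqOn x y (Set.Icc a b) :=
  ODE_solution_unique_of_mem_Icc_left (s := fun _ => Set.univ)
    (fun t ht => (hv t (Set.Ioc_subset_Icc_self ht)).lipschitzOnWith)
    (HasDerivAt.continuousOn hx)
    (fun t ht => (hx t (Set.Ioc_subset_Icc_self ht)).hasDerivWithinAt) (fun _ _ => trivial)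
    (HasDerivAt.continuousOn hy)
    (fun t ht => (hy t (Set.Ioc_subset_Icc_self ht)).hasDerivWithinAt) (fun _ _ => trivial) h

/-- Solutions of a scalar ODE with Lipschitz right-hand side preserve the strict order of their
initial values. -/
theorem ODE_solution_lt_of_lt_left {v : ℝ → ℝ → ℝ} {K : NNReal} {x y : ℝ → ℝ} {a b : ℝ}
    (hv : ∀ t ∈ Set.Icc a b, LipschitzWith K (v t))
    (hx : ∀ t ∈ Set.Icc a b, HasDerivAt x (v t (x t)) t)
    (hy : ∀ t ∈ Set.Icc a b, HasDerivAt y (v t (y t)) t)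
    (h : x a < y a) {t : ℝ} (ht : t ∈ Set.Icc a b) : x t < y t := by
  by_contra! hle
  have hsub : Set.Icc a t ⊆ Set.Icc a b := Set.Icc_subset_Icc_right ht.2
  have hc : ContinuousOn (x - y) (Set.Icc a t) :=
    (HasDerivAt.continuousOn fun s hs => hx s (hsub hs)).sub
      (HasDerivAt.continuousOn fun s hs => hy s (hsub hs))
  obtain ⟨s, hs, hxy⟩ :=
    intermediate_value_Icc ht.1 hc ⟨(sub_neg.2 h).le, sub_nonneg.2 hle⟩
  have hsub' : Set.Icc a s ⊆ Set.Icc a b := (Set.Icc_subset_Icc_right hs.2).trans hsub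
  exact h.ne <| ODE_solution_eqOn_Icc_of_eq_right (fun r hr => hv r (hsub' hr))
    (fun r hr => hx r (hsub' hr)) (fun r hr => hy r (hsub' hr)) (sub_eq_zero.1 hxy)
    (Set.left_mem_Icc.2 hs.1)

/-- Theorem 1 of the paper: the time-`t` solution map of the system of causal initial value
problems `dz^i = v^i(z^i, u^{<π_i}, t) dt`, `z^i(0) = u^i`, where each velocity `v^i` depends
on `u` only through coordinates of lower causal order, is continuous in `(z,t)` and uniformly
Lipschitz in `z`, is a triangular monotonically increasing (TMI) map of `u` with respect to the
causal ordering `π`: each component `f(u,t)_i` depends only on the coordinates `u^j` with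
`π j ≤ π i`, and is strictly increasing in `u^i`. -/
theorem causal_flow_is_TMI
    (d : ℕ) (π : Equiv.Perm (Fin d)) (K : ℝ) (hK : 0 ≤ K)
    (v : Fin d → ℝ → (Fin d → ℝ) → ℝ → ℝ)
    (hdep : ∀ (i : Fin d) (u u' : Fin d → ℝ),
      (∀ j, π j < π i → u j = u' j) → ∀ z t, v i z u t = v i z u' t)
    (hcont : ∀ (i : Fin d) (u : Fin d → ℝ),
      ContinuousOn (fun p : ℝ × ℝ => v i p.1 u p.2) (Set.univ ×ˢ Set.Icc 0 1))
    (hlip : ∀ (i : Fin d) (u : Fin d → ℝ) (z₁ z₂ : ℝ), ∀ t ∈ Set.Icc (0:ℝ) 1,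
      |v i z₁ u t - v i z₂ u t| ≤ K * |z₁ - z₂|)
    (z : (Fin d → ℝ) → Fin d → ℝ → ℝ)
    (hz0 : ∀ (u : Fin d → ℝ) (i : Fin d), z u i 0 = u i)
    (hz : ∀ (u : Fin d → ℝ) (i : Fin d), ∀ t ∈ Set.Icc (0:ℝ) 1,
      HasDerivAt (z u i) (v i (z u i t) u t) t)
    (f : (Fin d → ℝ) → ℝ → Fin d → ℝ)
    (hf : ∀ u t i, f u t i = z u i t) :
    ∀ t ∈ Set.Icc (0:ℝ) 1,
      (∀ (i : Fin d) (u u' : Fin d → ℝ),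
        (∀ j, π j ≤ π i → u j = u' j) → f u t i = f u' t i) ∧
      (∀ (i : Fin d) (u u' : Fin d → ℝ),
        (∀ j, j ≠ i → u j = u' j) → u i < u' i → f u t i < f u' t i) := by
  intro t ht
  have hlip' (i : Fin d) (u : Fin d → ℝ) (s : ℝ) (hs : s ∈ Set.Icc (0:ℝ) 1) :
      LipschitzWith K.toNNReal (fun x => v i x u s) :=
    LipschitzWith.of_dist_le_mul fun x y => by
      simpa only [Real.dist_eq, Real.coe_toNNReal K hK] using hlip i u x y s hs
  have hz' (i : Fin d) (u u' : Fin d → ℝ) (h : ∀ j, π j < π i → u j = u' j) (s : ℝ)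
      (hs : s ∈ Set.Icc (0:ℝ) 1) : HasDerivAt (z u' i) (v i (z u' i s) u s) s := by
    rw [hdep i u u' h]
    exact hz u' i s hs
  refine ⟨fun i u u' h => ?_, fun i u u' h hlt => ?_⟩
  · rw [hf, hf]
    refine ODE_solution_eqOn_Icc_of_eq_left (v := fun s x => v i x u s) (hlip' i u) (hz u i)
      (hz' i u u' fun j hj => h j hj.le) ?_ ht
    rw [hz0, hz0, h i le_rfl]
  · rw [hf, hf]
    refine ODE_solution_lt_of_lt_left (v := fun s x => v i x u s) (hlip' i u) (hz u i)
      (hz' i u u' fun j hj => h j fun hji => hj.ne (congrArg π hji)) ?_ ht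
    rwa [hz0, hz0]
end

section
/- Let v : ℝ → ℝ → ℝ be such that (z, t) ↦ v z t is continuous on ℝ × [0,1] and there is a constant K ≥ 0 with |v z₁ t − v z₂ t| ≤ K·|z₁ − z₂| for all z₁, z₂ ∈ ℝ and all t ∈ [0,1]. Suppose that for every u ∈ ℝ there is a solution α_u : [0,1] → ℝ of z' = v(z, t) with α_u(0) = u, and that for every x ∈ ℝ there is a solution β_x : [0,1] → ℝ of z' = v(z, t) with β_x(1) = x. Then the time-1 flow map F : ℝ → ℝ, F(u) = α_u(1), is well defined (independent of the chosen solution), strictly increasing, and a bijection of ℝ onto ℝ whose inverse sends x to β_x(0). -/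
open Set in
/-- Two solutions on `[a, b]` of an ODE with velocity uniformly Lipschitz in the state agree on
`[a, b]` as soon as they agree at one time, which may be an endpoint. -/
theorem eqOn_Icc_of_hasDerivAt_of_eq {E : Type*} [NormedAddCommGroup E] [NormedSpace ℝ E]
    {v : ℝ → E → E} {K : NNReal} {f g : ℝ → E} {a b t₀ : ℝ}
    (hv : ∀ t ∈ Icc a b, LipschitzWith K (v t))
    (hf : ∀ t ∈ Icc a b, HasDerivAt f (v t (f t)) t)
    (hg : ∀ t ∈ Icc a b, HasDerivAt g (v t (g t)) t)
    (ht₀ : t₀ ∈ Icc a b) (heq : f t₀ = g t₀) : EqOn f g (Icc a b) := by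
  have hfc : ContinuousOn f (Icc a b) := HasDerivAt.continuousOn hf
  have hgc : ContinuousOn g (Icc a b) := HasDerivAt.continuousOn hg
  rw [← Icc_union_Icc_eq_Icc ht₀.1 ht₀.2]
  have hl : Icc a t₀ ⊆ Icc a b := Icc_subset_Icc_right ht₀.2
  have hr : Icc t₀ b ⊆ Icc a b := Icc_subset_Icc_left ht₀.1
  refine EqOn.union ?_ ?_
  · have hs : Ioc a t₀ ⊆ Icc a b := Ioc_subset_Icc_self.trans hl
    exact ODE_solution_unique_of_mem_Icc_left (s := fun _ ↦ univ)
      (fun t ht ↦ (hv t (hs ht)).lipschitzOnWith)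
      (hfc.mono hl) (fun t ht ↦ (hf t (hs ht)).hasDerivWithinAt) (fun _ _ ↦ mem_univ _)
      (hgc.mono hl) (fun t ht ↦ (hg t (hs ht)).hasDerivWithinAt) (fun _ _ ↦ mem_univ _) heq
  · have hs : Ico t₀ b ⊆ Icc a b := Ico_subset_Icc_self.trans hr
    exact ODE_solution_unique_of_mem_Icc_right (s := fun _ ↦ univ)
      (fun t ht ↦ (hv t (hs ht)).lipschitzOnWith)
      (hfc.mono hr) (fun t ht ↦ (hf t (hs ht)).hasDerivWithinAt) (fun _ _ ↦ mem_univ _)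
      (hgc.mono hr) (fun t ht ↦ (hg t (hs ht)).hasDerivWithinAt) (fun _ _ ↦ mem_univ _) heq

open Set in
/-- Solutions on `[a, b]` of a scalar ODE with velocity uniformly Lipschitz in the state keep the
strict order of their initial values. -/
theorem lt_right_of_hasDerivAt_of_lt_left {v : ℝ → ℝ → ℝ} {K : NNReal} {f g : ℝ → ℝ} {a b : ℝ}
    (hab : a ≤ b) (hv : ∀ t ∈ Icc a b, LipschitzWith K (v t))
    (hf : ∀ t ∈ Icc a b, HasDerivAt f (v t (f t)) t)
    (hg : ∀ t ∈ Icc a b, HasDerivAt g (v t (g t)) t)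
    (hlt : f a < g a) : f b < g b := by
  by_contra! hle
  obtain ⟨t, ht, hzero⟩ : (0 : ℝ) ∈ (fun t ↦ f t - g t) '' Icc a b :=
    intermediate_value_Icc hab ((HasDerivAt.continuousOn hf).sub (HasDerivAt.continuousOn hg))
      ⟨(sub_neg.mpr hlt).le, sub_nonneg.mpr hle⟩
  exact hlt.ne
    (eqOn_Icc_of_hasDerivAt_of_eq hv hf hg ht (sub_eq_zero.mp hzero) (left_mem_Icc.mpr hab))

/-- The time-1 flow map of a one-dimensional ODE with velocity continuous on `ℝ × [0,1]` and
uniformly Lipschitz in the state, assuming solutions exist forward from every initial value `u`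
and backward from every terminal value `x`, is well defined (independent of the chosen
solution), strictly increasing, and a bijection of `ℝ` onto `ℝ` whose inverse sends `x` to the
time-0 value of the solution ending at `x`. (Prediction and abduction are mutually inverse.) -/
theorem time_one_flow_bijective
    (v : ℝ → ℝ → ℝ) (K : ℝ) (hK : 0 ≤ K)
    (hcont : ContinuousOn (fun p : ℝ × ℝ => v p.1 p.2) (Set.univ ×ˢ Set.Icc 0 1))
    (hlip : ∀ z₁ z₂ : ℝ, ∀ t ∈ Set.Icc (0:ℝ) 1, |v z₁ t - v z₂ t| ≤ K * |z₁ - z₂|)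
    (α β : ℝ → ℝ → ℝ)
    (hα0 : ∀ u, α u 0 = u)
    (hα : ∀ u, ∀ t ∈ Set.Icc (0:ℝ) 1, HasDerivAt (α u) (v (α u t) t) t)
    (hβ1 : ∀ x, β x 1 = x)
    (hβ : ∀ x, ∀ t ∈ Set.Icc (0:ℝ) 1, HasDerivAt (β x) (v (β x t) t) t) :
    (∀ (u : ℝ) (γ : ℝ → ℝ), γ 0 = u →
      (∀ t ∈ Set.Icc (0:ℝ) 1, HasDerivAt γ (v (γ t) t) t) → γ 1 = α u 1) ∧
    StrictMono (fun u => α u 1) ∧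
    Function.Bijective (fun u => α u 1) ∧
    (∀ u, β (α u 1) 0 = u) ∧
    (∀ x, α (β x 0) 1 = x) := by
  have hv : ∀ t ∈ Set.Icc (0 : ℝ) 1, LipschitzWith K.toNNReal (fun z ↦ v z t) := fun t ht ↦
    LipschitzWith.of_dist_le_mul fun z₁ z₂ ↦ by
      simpa only [Real.dist_eq, Real.coe_toNNReal K hK] using hlip z₁ z₂ t ht
  have h0 : (0 : ℝ) ∈ Set.Icc (0 : ℝ) 1 := Set.left_mem_Icc.mpr zero_le_one
  have h1 : (1 : ℝ) ∈ Set.Icc (0 : ℝ) 1 := Set.right_mem_Icc.mpr zero_le_one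
  have hmono : StrictMono (fun u => α u 1) := fun u w huw ↦
    lt_right_of_hasDerivAt_of_lt_left zero_le_one hv (hα u) (hα w) (by rwa [hα0, hα0])
  have hright : ∀ x, α (β x 0) 1 = x := fun x ↦
    (eqOn_Icc_of_hasDerivAt_of_eq hv (hα _) (hβ x) h0 (hα0 _) h1).trans (hβ1 x)
  refine ⟨fun u γ hγ0 hγ ↦ ?_, hmono, ⟨hmono.injective, fun x ↦ ⟨β x 0, hright x⟩⟩,
    fun u ↦ ?_, hright⟩
  · exact eqOn_Icc_of_hasDerivAt_of_eq hv hγ (hα u) h0 (hγ0.trans (hα0 u).symm) h1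
  · exact hmono.injective (hright (α u 1))
end
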